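/- Let Ω ⊂ ℂ² be a bounded convex Reinhardt domain, let H = {w ∈ ℂ : Δ_w ≠ ∅} where Δ_w = {z ∈ ℂ : (z, w) ∈ Ω}, so that each Δ_w (w ∈ H) is an open disk centered at the origin and Ω = ∪_{w ∈ H} Δ_w × {w}. Let φ₀, ψ₀ : ℂ → ℂ be bounded continuous functions, regarded as functions on Ω depending on z only; let f₁, f₂ be holomorphic polynomials in one variable, regarded as functions of z; and let g be holomorphic on H with ∫_H |g|² dA < ∞, regarded as a function of w. Then f₁g ∈ A²(Ω) and ⟨H^Ω_{φ₀}(f₁g), H^Ω_{ψ₀}(f₂g)⟩_{L²(Ω)} = ∫_H |g(w)|² (∫_{Δ_w} H^{Δ_w}_{φ₀}(f₁)(z)·conj(H^{Δ_w}_{ψ₀}(f₂)(z)) dA(z)) dA(w) + ∫_Ω H^Ω_{φ₀}(f₁g)(z, w)·conj(P^{Δ_w}(ψ₀f₂)(z)·g(w)) dV(z, w). -/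

import Mathlib

open MeasureTheory Metric Complex Filter Set Topology

noncomputable def innerP (Ω : Set (ℂ × ℂ)) (u v : ℂ × ℂ → ℂ) : ℂ :=
  ∫ p in Ω, u p * (starRingEnd ℂ) (v p)

def MemA2 (Ω : Set (ℂ × ℂ)) (f : ℂ × ℂ → ℂ) : Prop :=
  DifferentiableOn ℂ f Ω ∧ MemLp f 2 (volume.restrict Ω)

def IsBergmanProj (Ω : Set (ℂ × ℂ)) (P : (ℂ × ℂ → ℂ) → (ℂ × ℂ → ℂ)) : Prop :=
  ∀ u : ℂ × ℂ → ℂ, MemLp u 2 (volume.restrict Ω) →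
    MemA2 Ω (P u) ∧ ∀ g : ℂ × ℂ → ℂ, MemA2 Ω g →
      innerP Ω (fun p => u p - P u p) g = 0

noncomputable def hankelOp (P : (ℂ × ℂ → ℂ) → (ℂ × ℂ → ℂ)) (φ f : ℂ × ℂ → ℂ) :
    ℂ × ℂ → ℂ :=
  fun p => φ p * f p - P (fun q => φ q * f q) p

def IsCompactOnA2 (Ω : Set (ℂ × ℂ)) (T : (ℂ × ℂ → ℂ) → (ℂ × ℂ → ℂ)) : Prop :=
  ∀ f : ℕ → ℂ × ℂ → ℂ, (∀ n, MemA2 Ω (f n)) →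
    (∀ n, eLpNorm (f n) 2 (volume.restrict Ω) ≤ 1) →
    ∃ (k : ℕ → ℕ) (g : ℂ × ℂ → ℂ), StrictMono k ∧
      Tendsto (fun n => eLpNorm (fun p => T (f (k n)) p - g p) 2 (volume.restrict Ω))
        atTop (𝓝 0)

def HarmonicOnD (u : ℂ → ℂ) (U : Set ℂ) : Prop :=
  ContDiffOn ℝ 2 u U ∧
  ∀ z ∈ U, fderiv ℝ (fun w => fderiv ℝ u w 1) z 1
    + fderiv ℝ (fun w => fderiv ℝ u w Complex.I) z Complex.I = 0

def IsReinhardt (Ω : Set (ℂ × ℂ)) : Prop :=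
  ∀ p ∈ Ω, ∀ θ₁ θ₂ : ℝ, (Complex.exp (θ₁ * Complex.I) * (Prod.fst p),
    Complex.exp (θ₂ * Complex.I) * (Prod.snd p)) ∈ Ω


/-- The Bergman projection on the disk of radius `r` centered at the origin, given by the
explicit Bergman kernel. -/
noncomputable def diskProj (r : ℝ) (u : ℂ → ℂ) (z : ℂ) : ℂ :=
  (1 / Real.pi) * ∫ ξ in ball (0:ℂ) r,
    (r:ℂ)^2 / ((r:ℂ)^2 - z * (starRingEnd ℂ) ξ)^2 * u ξ

/-- The Hankel operator on the disk of radius `r` with symbol `φ`. -/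
noncomputable def diskHankel (r : ℝ) (φ f : ℂ → ℂ) : ℂ → ℂ :=
  fun z => φ z * f z - diskProj r (fun ξ => φ ξ * f ξ) z


lemma polar_int (F : ℂ → ℂ) (hm : Measurable F) (hi : Integrable F) :
    ∫ x, F x = ∫ ρ in Ioi (0:ℝ), (2 * Real.pi * ρ) • Real.circleAverage F 0 ρ := by
  rw [← Complex.integral_comp_polarCoord_symm, polarCoord_target]
  have hc : Continuous (fun p : ℝ × ℝ => Complex.polarCoord.symm p) := by
    simp only [Complex.polarCoord_symm_apply]; fun_prop
  have hI : IntegrableOn (fun p : ℝ × ℝ => p.1 • F (Complex.polarCoord.symm p))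
      (Ioi (0:ℝ) ×ˢ Ioo (-Real.pi) Real.pi) := by
    refine ⟨(measurable_fst.smul (hm.comp hc.measurable)).aestronglyMeasurable, ?_⟩
    have h2 := Complex.lintegral_comp_polarCoord_symm (fun x => ‖F x‖ₑ)
    rw [polarCoord_target] at h2
    have h3 := hi.2
    rw [HasFiniteIntegral, ← h2] at h3
    rw [HasFiniteIntegral]
    refine lt_of_eq_of_lt (setLIntegral_congr_fun
      (measurableSet_Ioi.prod measurableSet_Ioo) ?_) h3
    intro p hp
    simp only [enorm_smul, smul_eq_mul]
    congr 1
    rw [Real.enorm_eq_ofReal (le_of_lt hp.1)]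
  rw [Measure.volume_eq_prod] at hI ⊢
  rw [setIntegral_prod _ hI]
  refine setIntegral_congr_fun measurableSet_Ioi ?_
  intro ρ hρ
  simp only
  rw [integral_smul, Real.circleAverage_eq_integral_add (-Real.pi),
    intervalIntegral.integral_comp_add_right (fun θ => F (circleMap 0 ρ θ)),
    ← integral_Ioc_eq_integral_Ioo, ← intervalIntegral.integral_of_le (by linarith [Real.pi_pos])]
  rw [show (0:ℝ) + -Real.pi = -Real.pi by ring, show 2 * Real.pi + -Real.pi = Real.pi by ring,
    smul_smul]
  have : 2 * Real.pi * ρ * (2 * Real.pi)⁻¹ = ρ := by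
    field_simp
  rw [this]
  congr 2
  ext θ
  congr 1
  simp [circleMap, Complex.exp_mul_I]

/-- circle average of kernel times function -/
lemma circ_ker (r : ℝ) (hr : 0 < r) (h : ℂ → ℂ) (hd : DifferentiableOn ℂ h (ball 0 r))
    (z : ℂ) (hz : z ∈ ball (0:ℂ) r) (ρ : ℝ) (h0 : 0 < ρ) (h1 : ρ < r) :
    Real.circleAverage (fun ξ => (r:ℂ)^2 / ((r:ℂ)^2 - z * (starRingEnd ℂ) ξ)^2 * h ξ) 0 ρ
      = ((r:ℂ)^2)⁻¹ * deriv (fun ξ => ξ * h ξ) (ρ^2 / r^2 * z) := by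
  have hrC : (r:ℂ) ≠ 0 := by exact_mod_cast hr.ne'
  have hρC : (ρ:ℂ) ≠ 0 := by exact_mod_cast h0.ne'
  have hz' : ‖z‖ < r := by simpa using hz
  rw [Real.circleAverage_eq_circleIntegral h0.ne']
  rw [← two_pi_I_inv_smul_circleIntegral_sub_sq_inv_smul_of_differentiable (U := ball (0:ℂ) r)
    (c := 0) (R := ρ) (f := fun ξ => ξ * h ξ) isOpen_ball (closedBall_subset_ball h1)
    (differentiableOn_id.mul hd)]
  · rw [smul_eq_mul, smul_eq_mul, mul_left_comm (((r:ℂ)^2)⁻¹)]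
    congr 1
    rw [← smul_eq_mul (((r:ℂ)^2)⁻¹), ← circleIntegral.integral_smul]
    refine circleIntegral.integral_congr h0.le ?_
    intro ξ hξ
    have hn : ‖ξ‖ = ρ := by simpa using hξ
    have hξ0 : ξ ≠ 0 := by rw [← norm_pos_iff, hn]; exact h0
    have hc : (starRingEnd ℂ) ξ = ρ^2 / ξ := by
      rw [eq_div_iff hξ0, mul_comm, Complex.mul_conj, Complex.normSq_eq_norm_sq, hn]; simp
    simp only [smul_eq_mul, sub_zero]
    rw [hc]
    have e1 : (r:ℂ)^2 - z * (ρ^2 / ξ) = (r:ℂ)^2 * (ξ - ρ^2/r^2*z) / ξ := by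
      field_simp
    rw [e1]
    field_simp
  · simp only [mem_ball, dist_zero_right, norm_mul, norm_div, norm_pow, Complex.norm_real,
      Real.norm_eq_abs, abs_of_pos hr, abs_of_pos h0]
    rw [div_mul_eq_mul_div, div_lt_iff₀ (by positivity)]
    nlinarith [mul_pos h0 h0, mul_pos hr h0, mul_lt_mul_of_pos_left hz' (mul_pos h0 h0),
      mul_lt_mul_of_pos_left h1 (mul_pos h0 hr)]

lemma den_ne (r : ℝ) (z ξ : ℂ) (hz : ‖z‖ < r) (hξ : ‖ξ‖ ≤ r) :
    (r:ℂ)^2 - z * (starRingEnd ℂ) ξ ≠ 0 := by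
  have hr : 0 < r := lt_of_le_of_lt (norm_nonneg _) hz
  intro h
  have h2 : (r:ℂ)^2 = z * (starRingEnd ℂ) ξ := sub_eq_zero.mp h
  have h3 := congrArg norm h2
  simp only [norm_pow, Complex.norm_real, norm_mul, RCLike.norm_conj, Real.norm_eq_abs,
    abs_of_pos hr] at h3
  nlinarith [norm_nonneg z, norm_nonneg ξ, mul_le_mul_of_nonneg_left hξ (norm_nonneg z)]

lemma ker_cont (r : ℝ) (z : ℂ) (hz : ‖z‖ < r) :
    ContinuousOn (fun ξ => (r:ℂ)^2 / ((r:ℂ)^2 - z * (starRingEnd ℂ) ξ)^2) (closedBall 0 r) := by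
  refine ContinuousOn.div (by fun_prop) (by fun_prop) ?_
  intro ξ hξ
  exact pow_ne_zero _ (den_ne r z ξ hz (by simpa using hξ))

lemma ker_bdd (r : ℝ) (z : ℂ) (hz : ‖z‖ < r) :
    ∃ C, ∀ ξ ∈ ball (0:ℂ) r, ‖(r:ℂ)^2 / ((r:ℂ)^2 - z * (starRingEnd ℂ) ξ)^2‖ ≤ C := by
  obtain ⟨C, hC⟩ := (isCompact_closedBall (0:ℂ) r).exists_bound_of_continuousOn (ker_cont r z hz)
  exact ⟨C, fun ξ hξ => hC ξ (ball_subset_closedBall hξ)⟩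

lemma repro (r : ℝ) (h : ℂ → ℂ) (hd : DifferentiableOn ℂ h (ball 0 r))
    (hi : IntegrableOn h (ball 0 r)) (z : ℂ) (hz : z ∈ ball (0:ℂ) r) :
    diskProj r h z = h z := by
  have hz' : ‖z‖ < r := by simpa using hz
  have hr : 0 < r := lt_of_le_of_lt (norm_nonneg _) hz'
  have hrC : (r:ℂ) ≠ 0 := by exact_mod_cast hr.ne'
  set k : ℂ → ℂ := fun ξ => (r:ℂ)^2 / ((r:ℂ)^2 - z * (starRingEnd ℂ) ξ)^2 * h ξ with hk
  have hkc : ContinuousOn k (ball 0 r) :=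
    ((ker_cont r z hz').mono ball_subset_closedBall).mul hd.continuousOn
  have hki : IntegrableOn k (ball 0 r) := by
    obtain ⟨C, hC⟩ := ker_bdd r z hz'
    refine Integrable.bdd_mul (c := C) hi ?_ ?_
    · exact ((ker_cont r z hz').mono ball_subset_closedBall).aestronglyMeasurable measurableSet_ball
    · exact (ae_restrict_iff' measurableSet_ball).2 (ae_of_all _ hC)
  have hkm : Measurable ((ball (0:ℂ) r).indicator k) := by
    classical
    rw [← piecewise_eq_indicator]
    exact hkc.measurable_piecewise continuousOn_const measurableSet_ball
  unfold diskProj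
  rw [← integral_indicator measurableSet_ball,
    polar_int _ hkm ((integrable_indicator_iff measurableSet_ball).2 hki)]
  have e1 : ∫ ρ in Ioi (0:ℝ), (2 * Real.pi * ρ) • Real.circleAverage ((ball (0:ℂ) r).indicator k) 0 ρ
      = ∫ ρ in (0:ℝ)..r, (2 * Real.pi * ρ) •
        (((r:ℂ)^2)⁻¹ * deriv (fun ξ => ξ * h ξ) (ρ^2 / r^2 * z)) := by
    rw [intervalIntegral.integral_of_le hr.le, integral_Ioc_eq_integral_Ioo,
      ← Ioi_inter_Iio, ← setIntegral_indicator measurableSet_Iio]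
    refine setIntegral_congr_fun measurableSet_Ioi ?_
    intro ρ hρ
    have hρ0 : 0 < ρ := hρ
    by_cases h1 : ρ < r
    · simp only [indicator_of_mem (show ρ ∈ Iio r from h1)]
      rw [← circ_ker r hr h hd z hz ρ hρ h1]
      congr 1
      refine Real.circleAverage_congr_sphere ?_
      intro ξ hξ
      refine indicator_of_mem ?_ _
      have : ‖ξ‖ = ρ := by simpa [abs_of_pos hρ0] using hξ
      simpa [this] using h1
    · simp only [indicator_of_notMem (show ρ ∉ Iio r from h1)]
      have : Real.circleAverage ((ball (0:ℂ) r).indicator k) 0 ρ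
          = Real.circleAverage (fun _ => (0:ℂ)) 0 ρ := by
        refine Real.circleAverage_congr_sphere ?_
        intro ξ hξ
        refine indicator_of_notMem ?_ _
        have : ‖ξ‖ = ρ := by simpa [abs_of_pos hρ0] using hξ
        simpa [this] using h1
      rw [this, Real.circleAverage_const, smul_zero]
  rw [e1]
  have hdm : DifferentiableOn ℂ (fun ξ => ξ * h ξ) (ball 0 r) := differentiableOn_id.mul hd
  have hin : ∀ ρ ∈ Icc (0:ℝ) r, ((ρ:ℂ)^2 / r^2 * z) ∈ ball (0:ℂ) r := by
    intro ρ hρ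
    simp only [mem_ball, dist_zero_right, norm_mul, norm_div, norm_pow, Complex.norm_real,
      Real.norm_eq_abs, abs_of_pos hr, abs_of_nonneg hρ.1]
    have : ρ^2/r^2 ≤ 1 := by
      rw [div_le_one (by positivity)]
      exact pow_le_pow_left₀ hρ.1 hρ.2 2
    nlinarith [norm_nonneg z]
  -- FTC
  have hder : ∀ ρ ∈ uIcc (0:ℝ) r, HasDerivAt (fun ρ : ℝ => (Real.pi:ℂ) * (((ρ:ℂ)^2 / r^2) *
      h ((ρ:ℂ)^2 / r^2 * z)))
      ((2 * Real.pi * ρ) • (((r:ℂ)^2)⁻¹ * deriv (fun ξ => ξ * h ξ) (ρ^2 / r^2 * z))) ρ := by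
    intro ρ hρ
    rw [uIcc_of_le hr.le] at hρ
    have hm := hin ρ hρ
    have hh : HasDerivAt h (deriv h ((ρ:ℂ)^2 / r^2 * z)) ((ρ:ℂ)^2 / r^2 * z) :=
      (hd.differentiableAt (isOpen_ball.mem_nhds hm)).hasDerivAt
    have e2 : deriv (fun ξ => ξ * h ξ) ((ρ:ℂ)^2 / r^2 * z) =
        1 * h ((ρ:ℂ)^2 / r^2 * z) + ((ρ:ℂ)^2 / r^2 * z) * deriv h ((ρ:ℂ)^2 / r^2 * z) :=
      ((hasDerivAt_id _).mul hh).deriv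
    have hq : HasDerivAt (fun ρ : ℂ => ρ^2 / (r:ℂ)^2) (2 * (ρ:ℂ) / r^2) (ρ:ℂ) := by
      simpa using ((hasDerivAt_pow 2 (ρ:ℂ)).div_const ((r:ℂ)^2))
    have hq2 := hq.mul_const z
    have hcomp := HasDerivAt.comp (ρ:ℂ) (h₂ := h) (h := fun ρ : ℂ => ρ^2 / (r:ℂ)^2 * z) hh hq2
    have hfin := ((hq.mul hcomp).const_mul (Real.pi:ℂ)).comp_ofReal
    convert! hfin using 1
    rw [e2]
    simp only [Function.comp, Complex.real_smul]
    push_cast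
    ring
  have hint : IntervalIntegrable (fun ρ : ℝ => (2 * Real.pi * ρ) •
      (((r:ℂ)^2)⁻¹ * deriv (fun ξ => ξ * h ξ) ((ρ:ℂ)^2 / r^2 * z))) volume 0 r := by
    apply ContinuousOn.intervalIntegrable
    rw [uIcc_of_le hr.le]
    have hc2 : Continuous (fun ρ : ℝ => 2 * Real.pi * ρ) := by fun_prop
    refine ContinuousOn.smul hc2.continuousOn (ContinuousOn.mul continuousOn_const ?_)
    have hcc : Continuous (fun ρ : ℝ => ((ρ:ℂ)^2 / (r:ℂ)^2 * z)) := by fun_prop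
    exact (hdm.deriv isOpen_ball).continuousOn.comp hcc.continuousOn hin
  rw [intervalIntegral.integral_eq_sub_of_hasDerivAt hder hint]
  have hpi : (Real.pi:ℂ) ≠ 0 := by exact_mod_cast Real.pi_ne_zero
  have : (r:ℂ)^2/r^2 = 1 := div_self (pow_ne_zero _ hrC)
  simp [this]

noncomputable def kerFn (r : ℝ) (z ξ : ℂ) : ℂ :=
  (1 / Real.pi) * ((r:ℂ)^2 / ((r:ℂ)^2 - (starRingEnd ℂ) z * ξ)^2)

lemma kerFn_conj (r : ℝ) (z ξ : ℂ) : (starRingEnd ℂ) (kerFn r z ξ) =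
    (1 / Real.pi) * ((r:ℂ)^2 / ((r:ℂ)^2 - z * (starRingEnd ℂ) ξ)^2) := by
  simp [kerFn]

lemma diskProj_eq (r : ℝ) (u : ℂ → ℂ) (z : ℂ) :
    diskProj r u z = ∫ ξ in ball (0:ℂ) r, u ξ * (starRingEnd ℂ) (kerFn r z ξ) := by
  unfold diskProj
  rw [← integral_const_mul]
  congr 1; ext ξ
  rw [kerFn_conj]; ring

lemma kerFn_diff (r : ℝ) (z : ℂ) (hz : ‖z‖ < r) :
    DifferentiableOn ℂ (kerFn r z) (ball 0 r) := by
  unfold kerFn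
  refine DifferentiableOn.const_mul (DifferentiableOn.div (by fun_prop) (by fun_prop) ?_) _
  intro ξ hξ
  have := den_ne r z ξ hz (by simpa using (ball_subset_closedBall hξ))
  refine pow_ne_zero _ ?_
  have h2 := (map_ne_zero (starRingEnd ℂ)).2 this
  simpa using h2

lemma kerFn_memLp (r : ℝ) (z : ℂ) (hz : ‖z‖ < r) :
    MemLp (kerFn r z) 2 (volume.restrict (ball 0 r)) := by
  obtain ⟨C, hC⟩ := ker_bdd r z hz
  have : IsFiniteMeasure (volume.restrict (ball (0:ℂ) r)) :=
    ⟨by simpa using (measure_ball_lt_top (μ := volume) (x := (0:ℂ)) (r := r))⟩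
  refine MemLp.of_bound (C := ‖(1 / Real.pi : ℂ)‖ * C)
    ((kerFn_diff r z hz).continuousOn.aestronglyMeasurable measurableSet_ball)
    ((ae_restrict_iff' measurableSet_ball).2 (ae_of_all _ ?_))
  intro ξ hξ
  rw [← RCLike.norm_conj, kerFn_conj, norm_mul]
  exact mul_le_mul_of_nonneg_left (hC ξ hξ) (norm_nonneg _)

noncomputable abbrev diskM (r : ℝ) : Measure ℂ := volume.restrict (ball (0:ℂ) r)

instance (r : ℝ) : IsFiniteMeasure (diskM r) := ⟨by simpa using (measure_ball_lt_top (μ := volume) (x := (0:ℂ)) (r := r))⟩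

open Classical in
noncomputable def kap (r : ℝ) (z : ℂ) : Lp ℂ 2 (diskM r) :=
  if hz : ‖z‖ < r then (kerFn_memLp r z hz).toLp else 0

lemma inner_toLp (r : ℝ) (u v : ℂ → ℂ) (hu : MemLp u 2 (diskM r)) (hv : MemLp v 2 (diskM r)) :
    inner ℂ (hv.toLp) (hu.toLp) = ∫ z in ball (0:ℂ) r, u z * (starRingEnd ℂ) (v z) := by
  rw [L2.inner_def]
  refine integral_congr_ae ?_
  filter_upwards [hu.coeFn_toLp, hv.coeFn_toLp] with z h1 h2
  rw [h1, h2]; simp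

lemma kap_inner (r : ℝ) (z : ℂ) (hz : ‖z‖ < r) (u : ℂ → ℂ) (hu : MemLp u 2 (diskM r)) :
    inner ℂ (kap r z) (hu.toLp) = diskProj r u z := by
  rw [kap, dif_pos hz, inner_toLp, diskProj_eq]

noncomputable def repK (r : ℝ) : Submodule ℂ (Lp ℂ 2 (diskM r)) where
  carrier := {v | ∀ᵐ z ∂(diskM r), v z = inner ℂ (kap r z) v}
  zero_mem' := by
    filter_upwards [Lp.coeFn_zero ℂ 2 (diskM r)] with z hz
    rw [hz]; simp
  add_mem' := by
    intro a b ha hb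
    change ∀ᵐ z ∂(diskM r), _ = inner ℂ (kap r z) _
    filter_upwards [Lp.coeFn_add a b, ha, hb] with z hz h1 h2
    rw [hz, Pi.add_apply, h1, h2, inner_add_right]
  smul_mem' := by
    intro c a ha
    change ∀ᵐ z ∂(diskM r), _ = inner ℂ (kap r z) _
    filter_upwards [Lp.coeFn_smul c a, ha] with z hz h1
    rw [hz, Pi.smul_apply, h1, inner_smul_right, smul_eq_mul]

lemma repK_closed (r : ℝ) : IsClosed (repK r : Set (Lp ℂ 2 (diskM r))) := by
  refine IsSeqClosed.isClosed ?_
  intro x v hx hv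
  obtain ⟨ns, hns, hae⟩ := (tendstoInMeasure_of_tendsto_Lp hv).exists_seq_tendsto_ae
  have hall : ∀ᵐ z ∂(diskM r), ∀ n, x n z = inner ℂ (kap r z) (x n) := ae_all_iff.2 hx
  change ∀ᵐ z ∂(diskM r), v z = inner ℂ (kap r z) v
  filter_upwards [hae, hall] with z h1 h2
  refine tendsto_nhds_unique h1 ?_
  simp only [h2]
  exact (tendsto_const_nhds.inner hv).comp hns.tendsto_atTop

lemma holo_mem (r : ℝ) (h : ℂ → ℂ) (hd : DifferentiableOn ℂ h (ball 0 r))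
    (hi : MemLp h 2 (diskM r)) : hi.toLp ∈ repK r := by
  change ∀ᵐ z ∂(diskM r), (hi.toLp h : ℂ → ℂ) z = inner ℂ (kap r z) (hi.toLp h)
  filter_upwards [hi.coeFn_toLp, ae_restrict_mem measurableSet_ball] with z h1 h2
  rw [h1, kap_inner r z (by simpa using h2), repro r h hd _ z h2]
  exact hi.integrable (by norm_num)

lemma kap_mem (r : ℝ) (z : ℂ) : kap r z ∈ repK r := by
  unfold kap
  split_ifs with hz
  · exact holo_mem r _ (kerFn_diff r z hz) _
  · exact zero_mem _

lemma proj_exists (r : ℝ) (u : ℂ → ℂ) (hu : MemLp u 2 (diskM r)) :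
    ∃ k ∈ repK r, (∀ w ∈ repK r, inner ℂ w (hu.toLp - k) = 0) ∧ ‖k‖ ≤ ‖hu.toLp‖ ∧
      k =ᵐ[diskM r] diskProj r u := by
  have : CompleteSpace (repK r) := (repK_closed r).completeSpace_coe
  refine ⟨(repK r).starProjection hu.toLp, (repK r).starProjection_apply_mem _, ?_, ?_, ?_⟩
  · intro w hw
    exact (Submodule.mem_orthogonal _ _).1
      (Submodule.sub_starProjection_mem_orthogonal (K := repK r) hu.toLp) w hw
  · exact Submodule.norm_starProjection_apply_le _ _
  · have hm : (repK r).starProjection hu.toLp ∈ repK r := (repK r).starProjection_apply_mem _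
    change ∀ᵐ z ∂(diskM r), _ = inner ℂ (kap r z) _ at hm
    filter_upwards [hm, ae_restrict_mem measurableSet_ball] with z h1 h2
    rw [h1, ← kap_inner r z (by simpa using h2) u hu]
    have := (Submodule.mem_orthogonal _ _).1
      (Submodule.sub_starProjection_mem_orthogonal (K := repK r) hu.toLp) _ (kap_mem r z)
    rw [inner_sub_right, sub_eq_zero] at this
    exact this.symm

lemma proj_memLp (r : ℝ) (u : ℂ → ℂ) (hu : MemLp u 2 (diskM r)) :
    MemLp (diskProj r u) 2 (diskM r) := by
  obtain ⟨k, _, _, _, hk⟩ := proj_exists r u hu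
  exact (memLp_congr_ae hk).1 (Lp.memLp k)

lemma proj_norm (r : ℝ) (u : ℂ → ℂ) (hu : MemLp u 2 (diskM r)) :
    eLpNorm (diskProj r u) 2 (diskM r) ≤ eLpNorm u 2 (diskM r) := by
  obtain ⟨k, _, _, hn, hk⟩ := proj_exists r u hu
  rw [← eLpNorm_congr_ae hk]
  rw [Lp.norm_def, Lp.norm_def, ENNReal.toReal_le_toReal (Lp.eLpNorm_ne_top _)
    (Lp.eLpNorm_ne_top _)] at hn
  rwa [eLpNorm_congr_ae hu.coeFn_toLp] at hn

lemma proj_lintegral (r : ℝ) (u : ℂ → ℂ) (hu : MemLp u 2 (diskM r)) :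
    ∫⁻ z in ball (0:ℂ) r, ‖diskProj r u z‖ₑ ^ 2 ≤ ∫⁻ z in ball (0:ℂ) r, ‖u z‖ₑ ^ 2 := by
  have h := proj_norm r u hu
  have h2 := ENNReal.rpow_le_rpow h (show (0:ℝ) ≤ 2 by norm_num)
  rw [eLpNorm_eq_lintegral_rpow_enorm_toReal (by norm_num) (by norm_num),
    eLpNorm_eq_lintegral_rpow_enorm_toReal (by norm_num) (by norm_num),
    ← ENNReal.rpow_mul, ← ENNReal.rpow_mul] at h2
  simpa using h2

lemma orth_rep (r : ℝ) (v h : ℂ → ℂ) (hv : MemLp v 2 (diskM r)) (hh : MemLp h 2 (diskM r))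
    (hm : hh.toLp ∈ repK r) :
    ∫ z in ball (0:ℂ) r, h z * (starRingEnd ℂ) (v z - diskProj r v z) = 0 := by
  obtain ⟨k, _, ho, _, hk⟩ := proj_exists r v hv
  have h1 := ho _ hm
  rw [← inner_conj_symm, map_eq_zero] at h1
  have e : hv.toLp - k = (hv.sub (proj_memLp r v hv)).toLp := by
    apply Lp.ext
    filter_upwards [Lp.coeFn_sub hv.toLp k, hv.coeFn_toLp, hk,
      (hv.sub (proj_memLp r v hv)).coeFn_toLp] with z a1 a2 a3 a4
    rw [a1, a4, Pi.sub_apply, Pi.sub_apply, a2, a3]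
  rw [e, inner_toLp] at h1
  exact h1

lemma orth_holo (r : ℝ) (v h : ℂ → ℂ) (hv : MemLp v 2 (diskM r))
    (hd : DifferentiableOn ℂ h (ball 0 r)) (hh : MemLp h 2 (diskM r)) :
    ∫ z in ball (0:ℂ) r, h z * (starRingEnd ℂ) (v z - diskProj r v z) = 0 :=
  orth_rep r v h hv hh (holo_mem r h hd hh)

lemma orth_proj (r : ℝ) (v u : ℂ → ℂ) (hv : MemLp v 2 (diskM r)) (hu : MemLp u 2 (diskM r)) :
    ∫ z in ball (0:ℂ) r, diskProj r u z * (starRingEnd ℂ) (v z - diskProj r v z) = 0 := by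
  refine orth_rep r v _ hv (proj_memLp r u hu) ?_
  obtain ⟨k, hkm, _, _, hk⟩ := proj_exists r u hu
  have : (proj_memLp r u hu).toLp = k := by
    apply Lp.ext
    exact (MemLp.coeFn_toLp _).trans hk.symm
  rw [this]; exact hkm

lemma slice_integral (Ω : Set (ℂ × ℂ)) (H : Set ℂ) (R : ℂ → ℝ) (hΩ : MeasurableSet Ω)
    (hH : MeasurableSet H) (hmem : ∀ z w, (z, w) ∈ Ω ↔ w ∈ H ∧ z ∈ ball (0:ℂ) (R w))
    (F : ℂ × ℂ → ℂ) (hF : IntegrableOn F Ω) :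
    ∫ p in Ω, F p = ∫ w in H, ∫ z in ball (0:ℂ) (R w), F (z, w) := by
  have hI : Integrable (Ω.indicator F) := (integrable_indicator_iff hΩ).2 hF
  rw [← integral_indicator hΩ, ← integral_indicator hH]
  rw [Measure.volume_eq_prod] at hI ⊢
  rw [integral_prod_symm _ hI]
  congr 1; ext w
  by_cases hw : w ∈ H
  · rw [indicator_of_mem hw, ← integral_indicator measurableSet_ball]
    congr 1; ext z
    by_cases hz : z ∈ ball (0:ℂ) (R w)
    · rw [indicator_of_mem hz, indicator_of_mem ((hmem z w).2 ⟨hw, hz⟩)]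
    · rw [indicator_of_notMem hz, indicator_of_notMem (fun h => hz ((hmem z w).1 h).2)]
  · rw [indicator_of_notMem hw]
    rw [← integral_zero ℂ ℂ]
    congr 1; ext z
    exact indicator_of_notMem (fun h => hw ((hmem z w).1 h).1) _

lemma slice_lintegral (Ω : Set (ℂ × ℂ)) (H : Set ℂ) (R : ℂ → ℝ) (hΩ : MeasurableSet Ω)
    (hH : MeasurableSet H) (hmem : ∀ z w, (z, w) ∈ Ω ↔ w ∈ H ∧ z ∈ ball (0:ℂ) (R w))
    (F : ℂ × ℂ → ENNReal) (hF : AEMeasurable F (volume.restrict Ω)) :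
    ∫⁻ p in Ω, F p = ∫⁻ w in H, ∫⁻ z in ball (0:ℂ) (R w), F (z, w) := by
  have hI : AEMeasurable (Ω.indicator F) := (aemeasurable_indicator_iff hΩ).2 hF
  rw [← lintegral_indicator hΩ, ← lintegral_indicator hH]
  rw [Measure.volume_eq_prod] at hI ⊢
  rw [lintegral_prod_symm _ hI]
  congr 1; ext w
  by_cases hw : w ∈ H
  · rw [indicator_of_mem hw, ← lintegral_indicator measurableSet_ball]
    congr 1; ext z
    by_cases hz : z ∈ ball (0:ℂ) (R w)
    · rw [indicator_of_mem hz, indicator_of_mem ((hmem z w).2 ⟨hw, hz⟩)]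
    · rw [indicator_of_notMem hz, indicator_of_notMem (fun h => hz ((hmem z w).1 h).2)]
  · rw [indicator_of_notMem hw]
    rw [← lintegral_zero (α := ℂ) (μ := volume)]
    congr 1; ext z
    exact indicator_of_notMem (fun h => hw ((hmem z w).1 h).1) _

lemma slice_holo (Ω : Set (ℂ × ℂ)) (H : Set ℂ) (R : ℂ → ℝ)
    (hmem : ∀ z w, (z, w) ∈ Ω ↔ w ∈ H ∧ z ∈ ball (0:ℂ) (R w))
    (Q : ℂ × ℂ → ℂ) (hQ : DifferentiableOn ℂ Q Ω) (w : ℂ) (hw : w ∈ H) :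
    DifferentiableOn ℂ (fun z => Q (z, w)) (ball 0 (R w)) := by
  refine hQ.comp (f := fun z : ℂ => (z, w)) (by fun_prop) ?_
  intro z hz
  exact (hmem z w).2 ⟨hw, hz⟩

lemma slice_memLp (Ω : Set (ℂ × ℂ)) (H : Set ℂ) (R : ℂ → ℝ) (hΩ : MeasurableSet Ω)
    (hH : MeasurableSet H) (hmem : ∀ z w, (z, w) ∈ Ω ↔ w ∈ H ∧ z ∈ ball (0:ℂ) (R w))
    (Q : ℂ × ℂ → ℂ) (hQ : DifferentiableOn ℂ Q Ω) (hL : MemLp Q 2 (volume.restrict Ω)) :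
    ∀ᵐ w ∂(volume.restrict H), MemLp (fun z => Q (z, w)) 2 (diskM (R w)) := by
  rw [ae_restrict_iff' hH]
  have hi : IntegrableOn (fun p => ‖Q p‖^2) Ω := (memLp_two_iff_integrable_sq_norm hL.1).1 hL
  have hI : Integrable (Ω.indicator (fun p => ‖Q p‖^2)) := (integrable_indicator_iff hΩ).2 hi
  rw [Measure.volume_eq_prod] at hI
  filter_upwards [hI.prod_left_ae] with w h1 hw
  have hms : AEStronglyMeasurable (fun z => Q (z, w)) (diskM (R w)) :=
    (slice_holo Ω H R hmem Q hQ w hw).continuousOn.aestronglyMeasurable measurableSet_ball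
  rw [memLp_two_iff_integrable_sq_norm hms]
  refine (integrable_indicator_iff measurableSet_ball).1 ?_
  refine h1.congr (ae_of_all _ fun z => ?_)
  by_cases hz : z ∈ ball (0:ℂ) (R w)
  · simp only [indicator_of_mem hz, indicator_of_mem ((hmem z w).2 ⟨hw, hz⟩)]
  · simp only [indicator_of_notMem hz, indicator_of_notMem (fun h => hz ((hmem z w).1 h).2)]

lemma proj_meas (R : ℂ → ℝ) (hR : Measurable R) (u : ℂ → ℂ) (hu : Continuous u) :
    Measurable (fun p : ℂ × ℂ => diskProj (R p.2) u p.1) := by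
  unfold diskProj
  refine Measurable.const_mul ?_ _
  have e : (fun p : ℂ × ℂ => ∫ ξ in ball (0:ℂ) (R p.2),
      ((R p.2 : ℝ):ℂ)^2 / (((R p.2 : ℝ):ℂ)^2 - p.1 * (starRingEnd ℂ) ξ)^2 * u ξ)
      = fun p : ℂ × ℂ => ∫ ξ, ({q : (ℂ × ℂ) × ℂ | ‖q.2‖ < R q.1.2}).indicator (fun q =>
      ((R q.1.2 : ℝ):ℂ)^2 / (((R q.1.2 : ℝ):ℂ)^2 - q.1.1 * (starRingEnd ℂ) q.2)^2 * u q.2) (p, ξ) := by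
    ext p
    rw [← integral_indicator measurableSet_ball]
    congr 1; ext ξ
    simp only [indicator, mem_ball, dist_zero_right, mem_ofPred_eq]
  rw [e]
  refine (StronglyMeasurable.integral_prod_right' (f := _) ?_).measurable
  refine Measurable.stronglyMeasurable ?_
  have hRq : Measurable (fun q : (ℂ × ℂ) × ℂ => R q.1.2) := hR.comp (by fun_prop)
  refine Measurable.indicator ?_ (measurableSet_lt (by fun_prop) hRq)
  have hRC : Measurable (fun q : (ℂ × ℂ) × ℂ => ((R q.1.2 : ℝ) : ℂ)) :=
    Complex.measurable_ofReal.comp hRq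
  have hconj : Measurable (fun q : (ℂ × ℂ) × ℂ => (starRingEnd ℂ) q.2) :=
    Complex.continuous_conj.measurable.comp measurable_snd
  have h11 : Measurable (fun q : (ℂ × ℂ) × ℂ => q.1.1) := by fun_prop
  have hu2 : Measurable (fun q : (ℂ × ℂ) × ℂ => u q.2) := hu.measurable.comp measurable_snd
  exact ((hRC.pow_const 2).div ((((hRC.pow_const 2).sub (h11.mul hconj))).pow_const 2)).mul hu2

lemma cont_memLp (r : ℝ) (u : ℂ → ℂ) (hu : Continuous u) : MemLp u 2 (diskM r) := by
  obtain ⟨C, hC⟩ := (isCompact_closedBall (0:ℂ) r).exists_bound_of_continuousOn hu.continuousOn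
  exact MemLp.of_bound (C := C) hu.aestronglyMeasurable
    ((ae_restrict_iff' measurableSet_ball).2
      (ae_of_all _ fun ξ hξ => hC ξ (ball_subset_closedBall hξ)))

lemma projg_memLp (Ω : Set (ℂ × ℂ)) (H : Set ℂ) (R : ℂ → ℝ) (hΩ : MeasurableSet Ω)
    (hH : MeasurableSet H) (hmem : ∀ z w, (z, w) ∈ Ω ↔ w ∈ H ∧ z ∈ ball (0:ℂ) (R w))
    (hR : Measurable R) (B : ℝ) (hB : ∀ w, R w ≤ B) (u : ℂ → ℂ) (hu : Continuous u)
    (g : ℂ → ℂ) (hg : MemLp g 2 (volume.restrict H))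
    (hgm : AEStronglyMeasurable (fun p : ℂ × ℂ => g p.2) (volume.restrict Ω)) :
    MemLp (fun p : ℂ × ℂ => diskProj (R p.2) u p.1 * g p.2) 2 (volume.restrict Ω) := by
  have hm := (proj_meas R hR u hu).aestronglyMeasurable (μ := volume.restrict Ω)
  refine ⟨hm.mul hgm, ?_⟩
  rw [eLpNorm_lt_top_iff_lintegral_rpow_enorm_lt_top (by norm_num) (by norm_num)]
  have hms : AEMeasurable (fun p : ℂ × ℂ => ‖diskProj (R p.2) u p.1 * g p.2‖ₑ ^
      (ENNReal.toReal 2)) (volume.restrict Ω) := (hm.mul hgm).enorm.pow_const _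
  rw [slice_lintegral Ω H R hΩ hH hmem _ hms]
  have hg2 := hg.2
  rw [eLpNorm_lt_top_iff_lintegral_rpow_enorm_lt_top (by norm_num) (by norm_num)] at hg2
  have hu2 := (cont_memLp B u hu).2
  rw [eLpNorm_lt_top_iff_lintegral_rpow_enorm_lt_top (by norm_num) (by norm_num)] at hu2
  simp only [ENNReal.toReal_ofNat, ENNReal.rpow_ofNat] at *
  have hbound : ∀ w, ∫⁻ z in ball (0:ℂ) (R w), ‖diskProj (R w) u z * g w‖ₑ ^ 2
      ≤ (∫⁻ z in ball (0:ℂ) B, ‖u z‖ₑ ^ 2) * ‖g w‖ₑ ^ 2 := by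
    intro w
    simp only [enorm_mul, mul_pow]
    rw [lintegral_mul_const' _ _ (by simp)]
    refine mul_le_mul_left ?_ _
    exact (proj_lintegral _ u (cont_memLp _ u hu)).trans
      (lintegral_mono_set (ball_subset_ball (hB w)))
  refine (lintegral_mono hbound).trans_lt ?_
  rw [lintegral_const_mul' _ _ hu2.ne]
  exact ENNReal.mul_lt_top hu2 hg2

lemma ug_memLp (Ω : Set (ℂ × ℂ)) (H : Set ℂ) (R : ℂ → ℝ)
    (hmem : ∀ z w, (z, w) ∈ Ω ↔ w ∈ H ∧ z ∈ ball (0:ℂ) (R w)) (hΩ : MeasurableSet Ω)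
    (B : ℝ) (hB : ∀ w, R w ≤ B) (u : ℂ → ℂ) (hu : Continuous u)
    (g : ℂ → ℂ) (hg : MemLp g 2 (volume.restrict H)) :
    MemLp (fun p : ℂ × ℂ => u p.1 * g p.2) 2 (volume.restrict Ω) := by
  have h1 := hg.comp_snd (diskM B)
  rw [diskM, Measure.prod_restrict, ← Measure.volume_eq_prod] at h1
  have hsub : Ω ⊆ ball (0:ℂ) B ×ˢ H := by
    rintro ⟨z, w⟩ hp
    have := (hmem z w).1 hp
    exact ⟨ball_subset_ball (hB w) this.2, this.1⟩
  have h2 := h1.mono_measure (Measure.restrict_mono hsub le_rfl)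
  obtain ⟨C, hC⟩ := (isCompact_closedBall (0:ℂ) B).exists_bound_of_continuousOn hu.continuousOn
  have hum : Continuous (fun p : ℂ × ℂ => u p.1) := by fun_prop
  refine h2.of_le_mul (c := C) (hum.aestronglyMeasurable.mul h2.1) ?_
  rw [ae_restrict_iff' hΩ]
  refine ae_of_all _ fun p hp => ?_
  rw [norm_mul]
  exact mul_le_mul_of_nonneg_right (hC _ (ball_subset_closedBall (hsub hp).1)) (norm_nonneg _)

lemma integrable_mul_conj {α : Type*} [MeasurableSpace α] {μ : Measure α} {u v : α → ℂ}
    (hu : MemLp u 2 μ) (hv : MemLp v 2 μ) :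
    Integrable (fun p => u p * (starRingEnd ℂ) (v p)) μ := by
  have := hu.integrable_mul (q := 2) hv.star
  exact this

lemma slice_calc (r : ℝ) (u₁ u₂ Q : ℂ → ℂ) (c : ℂ) (h₁ : MemLp u₁ 2 (diskM r))
    (h₂ : MemLp u₂ 2 (diskM r)) (hQd : DifferentiableOn ℂ Q (ball 0 r))
    (hQ : MemLp Q 2 (diskM r)) :
    ∫ z in ball (0:ℂ) r, (u₁ z * c - Q z) *
        (starRingEnd ℂ) (u₂ z * c - diskProj r u₂ z * c) =
      ((‖c‖ ^ 2 : ℝ) : ℂ) * ∫ z in ball (0:ℂ) r, (u₁ z - diskProj r u₁ z) *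
        (starRingEnd ℂ) (u₂ z - diskProj r u₂ z) := by
  have hv : MemLp (fun z => u₂ z - diskProj r u₂ z) 2 (diskM r) := h₂.sub (proj_memLp r u₂ h₂)
  have hp₁ := proj_memLp r u₁ h₁
  have hd : MemLp (fun z => u₁ z - diskProj r u₁ z) 2 (diskM r) := h₁.sub hp₁
  have i1 := integrable_mul_conj hd hv
  have i2 := integrable_mul_conj hp₁ hv
  have i3 := integrable_mul_conj hQ hv
  have o1 := orth_proj r u₂ u₁ h₂ h₁
  have o2 := orth_holo r u₂ Q h₂ hQd hQ
  have hc : ((‖c‖ ^ 2 : ℝ) : ℂ) = c * (starRingEnd ℂ) c := by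
    rw [Complex.mul_conj, Complex.normSq_eq_norm_sq]
  calc _ = ∫ z in ball (0:ℂ) r, (((‖c‖ ^ 2 : ℝ) : ℂ) * ((u₁ z - diskProj r u₁ z) *
        (starRingEnd ℂ) (u₂ z - diskProj r u₂ z)) + ((‖c‖ ^ 2 : ℝ) : ℂ) * (diskProj r u₁ z *
        (starRingEnd ℂ) (u₂ z - diskProj r u₂ z))) - (starRingEnd ℂ) c * (Q z *
        (starRingEnd ℂ) (u₂ z - diskProj r u₂ z)) := by
        congr 1; ext z
        rw [hc]
        simp only [map_sub, map_mul]
        ring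
    _ = _ := by
        have i4 : Integrable (fun z => ((‖c‖ ^ 2 : ℝ) : ℂ) * ((u₁ z - diskProj r u₁ z) *
            (starRingEnd ℂ) (u₂ z - diskProj r u₂ z)) + ((‖c‖ ^ 2 : ℝ) : ℂ) * (diskProj r u₁ z *
            (starRingEnd ℂ) (u₂ z - diskProj r u₂ z))) (diskM r) :=
          (i1.const_mul _).add (i2.const_mul _)
        rw [integral_sub i4 (i3.const_mul _),
          integral_add (i1.const_mul _) (i2.const_mul _), integral_const_mul, integral_const_mul,
          integral_const_mul, o1, o2]
        simp

/-- Slicing identity for the inner product of two Hankel operators on a bounded convex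
Reinhardt domain in `ℂ²`, with symbols depending only on `z`. -/
theorem hankel_inner_product_slicing_identity
    (Ω : Set (ℂ × ℂ)) (hΩopen : IsOpen Ω) (hΩne : Ω.Nonempty)
    (hΩconv : Convex ℝ Ω) (hΩbdd : Bornology.IsBounded Ω)
    (hΩRein : IsReinhardt Ω)
    -- the slices and their radii
    (Δ : ℂ → Set ℂ) (hΔ : ∀ w, Δ w = {z : ℂ | (z, w) ∈ Ω})
    (Hset : Set ℂ) (hHset : Hset = {w : ℂ | (Δ w).Nonempty})
    (R : ℂ → ℝ) (hR : ∀ w, R w = sSup ((fun z : ℂ => ‖z‖) '' Δ w))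
    (hslice : ∀ w ∈ Hset, Δ w = ball (0:ℂ) (R w))
    -- the symbols, depending on `z` only
    (φ₀ ψ₀ : ℂ → ℂ) (hφ₀ : Continuous φ₀) (hψ₀ : Continuous ψ₀)
    (M : ℝ) (hφ₀bdd : ∀ z, ‖φ₀ z‖ ≤ M) (hψ₀bdd : ∀ z, ‖ψ₀ z‖ ≤ M)
    -- holomorphic polynomials in `z`
    (f₁ f₂ : Polynomial ℂ)
    -- a square-integrable holomorphic function of `w`
    (g : ℂ → ℂ) (hg : DifferentiableOn ℂ g Hset)
    (hgL2 : MemLp g 2 (volume.restrict Hset))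
    -- the Bergman projection of `Ω`
    (P : (ℂ × ℂ → ℂ) → (ℂ × ℂ → ℂ)) (hP : IsBergmanProj Ω P) :
    MemA2 Ω (fun p => f₁.eval p.1 * g p.2) ∧
    innerP Ω
        (hankelOp P (fun p => φ₀ p.1) (fun p => f₁.eval p.1 * g p.2))
        (hankelOp P (fun p => ψ₀ p.1) (fun p => f₂.eval p.1 * g p.2))
      = (∫ w in Hset, ((‖g w‖ ^ 2 : ℝ) : ℂ) *
          ∫ z in ball (0:ℂ) (R w),
            diskHankel (R w) φ₀ (fun ζ => f₁.eval ζ) z *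
              (starRingEnd ℂ) (diskHankel (R w) ψ₀ (fun ζ => f₂.eval ζ) z))
        + ∫ p in Ω,
            hankelOp P (fun q => φ₀ q.1) (fun q => f₁.eval q.1 * g q.2) p *
              (starRingEnd ℂ)
                (diskProj (R p.2) (fun ξ => ψ₀ ξ * f₂.eval ξ) p.1 * g p.2) := by
  have hΩm : MeasurableSet Ω := hΩopen.measurableSet
  have hmem : ∀ z w, (z, w) ∈ Ω ↔ w ∈ Hset ∧ z ∈ ball (0:ℂ) (R w) := by
    intro z w
    have hz : (z, w) ∈ Ω ↔ z ∈ Δ w := by rw [hΔ]; rfl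
    rw [hz]
    constructor
    · intro h
      have hw : w ∈ Hset := by rw [hHset]; exact ⟨z, h⟩
      exact ⟨hw, by rw [← hslice w hw]; exact h⟩
    · rintro ⟨hw, h⟩
      rw [hslice w hw]; exact h
  have hHo : IsOpen Hset := by
    have : Hset = Prod.snd '' Ω := by
      rw [hHset]; ext w
      constructor
      · rintro ⟨z, hz⟩
        rw [hΔ] at hz
        exact ⟨(z, w), hz, rfl⟩
      · rintro ⟨⟨z, w'⟩, hz, rfl⟩
        refine ⟨z, ?_⟩
        rw [hΔ]; exact hz
    rw [this]
    exact isOpenMap_snd _ hΩopen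
  have hHm := hHo.measurableSet
  obtain ⟨B, hB0, hB⟩ : ∃ B : ℝ, 0 ≤ B ∧ ∀ w, ∀ z ∈ Δ w, ‖z‖ ≤ B := by
    obtain ⟨B, hB⟩ := hΩbdd.exists_norm_le
    refine ⟨max B 0, le_max_right _ _, fun w z hz => ?_⟩
    rw [hΔ] at hz
    exact ((norm_fst_le (z, w)).trans (hB _ hz)).trans (le_max_left _ _)
  have hRB : ∀ w, R w ≤ B := by
    intro w
    rw [hR]
    refine Real.sSup_le ?_ hB0
    rintro _ ⟨z, hz, rfl⟩
    exact hB w z hz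
  have hR0 : ∀ w, 0 ≤ R w := by
    intro w
    rw [hR]
    refine Real.sSup_nonneg ?_
    rintro _ ⟨z, hz, rfl⟩
    exact norm_nonneg z
  have hRm : Measurable R := by
    refine measurable_of_Ioi fun a => ?_
    rcases lt_or_ge a 0 with ha | ha
    · have : R ⁻¹' Ioi a = univ := eq_univ_of_forall fun w => ha.trans_le (hR0 w)
      rw [this]; exact MeasurableSet.univ
    · have : R ⁻¹' Ioi a = Prod.snd '' (Ω ∩ {p | a < ‖p.1‖}) := by
        ext w
        constructor
        · intro h
          have h' : a < R w := h
          rw [hR] at h'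
          have hne : ((fun z : ℂ => ‖z‖) '' Δ w).Nonempty := by
            by_contra hcon
            rw [not_nonempty_iff_eq_empty] at hcon
            rw [hcon, Real.sSup_empty] at h'
            exact absurd h' (not_lt.2 ha)
          obtain ⟨_, ⟨z, hz, rfl⟩, hlt⟩ := exists_lt_of_lt_csSup hne h'
          rw [hΔ] at hz
          exact ⟨(z, w), ⟨hz, hlt⟩, rfl⟩
        · rintro ⟨⟨z, w'⟩, ⟨hz, hlt⟩, rfl⟩
          have hz' := ((hmem z w').1 hz).2
          have : ‖z‖ < R w' := by simpa using hz'
          exact lt_trans hlt this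
      rw [this]
      refine (isOpenMap_snd _ (hΩopen.inter ?_)).measurableSet
      exact isOpen_lt continuous_const (by fun_prop)
  have hpoly : ∀ f : Polynomial ℂ, Continuous (fun z : ℂ => f.eval z) := fun f => f.continuous
  have hu₁ : Continuous (fun z => φ₀ z * f₁.eval z) := hφ₀.mul (hpoly f₁)
  have hu₂ : Continuous (fun z => ψ₀ z * f₂.eval z) := hψ₀.mul (hpoly f₂)
  have hA : MemA2 Ω (fun p => f₁.eval p.1 * g p.2) := by
    refine ⟨?_, ug_memLp Ω Hset R hmem hΩm B hRB _ (hpoly f₁) g hgL2⟩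
    refine DifferentiableOn.mul ?_ ?_
    · exact (f₁.differentiable.comp differentiable_fst).differentiableOn
    · exact hg.comp differentiable_snd.differentiableOn
        (fun p hp => ((hmem p.1 p.2).1 hp).1)
  refine ⟨hA, ?_⟩
  have hF₁ : MemLp (fun p : ℂ × ℂ => φ₀ p.1 * (f₁.eval p.1 * g p.2)) 2 (volume.restrict Ω) := by
    have := ug_memLp Ω Hset R hmem hΩm B hRB _ hu₁ g hgL2
    simpa only [mul_assoc] using this
  have hF₂' := ug_memLp Ω Hset R hmem hΩm B hRB _ hu₂ g hgL2
  have hF₂ : MemLp (fun p : ℂ × ℂ => ψ₀ p.1 * (f₂.eval p.1 * g p.2)) 2 (volume.restrict Ω) := by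
    simpa only [mul_assoc] using hF₂'
  obtain ⟨hQ₁, hQ₁o⟩ := hP _ hF₁
  obtain ⟨hQ₂, -⟩ := hP _ hF₂
  have hgm : AEStronglyMeasurable (fun p : ℂ × ℂ => g p.2) (volume.restrict Ω) := by
    simpa using (ug_memLp Ω Hset R hmem hΩm B hRB (fun _ => 1) continuous_const g hgL2).1
  have hD := projg_memLp Ω Hset R hΩm hHm hmem hRm B hRB _ hu₂ g hgL2 hgm
  set X : ℂ × ℂ → ℂ := hankelOp P (fun p => φ₀ p.1) (fun p => f₁.eval p.1 * g p.2) with hX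
  have hXm : MemLp X 2 (volume.restrict Ω) := hF₁.sub hQ₁.2
  have hXo : ∫ p in Ω, X p * (starRingEnd ℂ)
      (P (fun q => ψ₀ q.1 * (f₂.eval q.1 * g q.2)) p) = 0 := hQ₁o _ hQ₂
  have j1 := integrable_mul_conj hXm hF₂
  have j2 := integrable_mul_conj hXm hQ₂.2
  have j3 := integrable_mul_conj hXm hD
  have j4 := integrable_mul_conj hXm (hF₂.sub hD)
  simp only [Pi.sub_apply] at j4
  have s1 : innerP Ω X (hankelOp P (fun p => ψ₀ p.1) (fun p => f₂.eval p.1 * g p.2))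
      = ∫ p in Ω, X p * (starRingEnd ℂ) (ψ₀ p.1 * (f₂.eval p.1 * g p.2)) := by
    unfold innerP
    rw [← sub_zero (∫ p in Ω, X p * (starRingEnd ℂ) (ψ₀ p.1 * (f₂.eval p.1 * g p.2))), ← hXo,
      ← integral_sub j1 j2]
    congr 1; ext p
    simp only [hankelOp, map_sub]
    ring
  rw [s1, ← sub_eq_iff_eq_add, ← integral_sub j1 j3]
  have s2 : ∀ p : ℂ × ℂ, X p * (starRingEnd ℂ) (ψ₀ p.1 * (f₂.eval p.1 * g p.2)) -
      X p * (starRingEnd ℂ) (diskProj (R p.2) (fun ξ => ψ₀ ξ * f₂.eval ξ) p.1 * g p.2) =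
      X p * (starRingEnd ℂ) (ψ₀ p.1 * (f₂.eval p.1 * g p.2) -
        diskProj (R p.2) (fun ξ => ψ₀ ξ * f₂.eval ξ) p.1 * g p.2) := by
    intro p
    rw [map_sub]; ring
  simp only [s2]
  rw [slice_integral Ω Hset R hΩm hHm hmem _ j4]
  refine integral_congr_ae ?_
  filter_upwards [slice_memLp Ω Hset R hΩm hHm hmem _ hQ₁.1 hQ₁.2, ae_restrict_mem hHm] with w h1 hw
  have key := slice_calc (R w) (fun z => φ₀ z * f₁.eval z) (fun z => ψ₀ z * f₂.eval z) _ (g w)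
    (cont_memLp _ _ hu₁) (cont_memLp _ _ hu₂)
    (slice_holo Ω Hset R hmem _ hQ₁.1 w hw) h1
  simp only [diskHankel]
  rw [← key]
  congr 1; ext z
  simp only [hX, hankelOp, mul_assoc]
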